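/- arXiv:1506.04286 — 6 statements merged into one kernel-verified Lean document; each statement's English description precedes it below -/
import Mathlib

section
/- Let l ≥ 3 be odd and let L₂ = ℚ₂[x]/(x^l − 2) with λ the image of x, so λ^l = 2 and L₂ is a totally ramified field extension of ℚ₂ of degree l. Then: (1) for every u ∈ ℤ₂^× (viewed in L₂) there exists s ∈ L₂^× with 1 + 2u + λ^{−2} = s²·(1 + λ² + λ^{l+2}); and (2) for every u ∈ ℤ₂ there exists s ∈ L₂^× with 1 + 4u + λ^{−2} = s²·(1 + λ²). (These are the square-class computations for the residue disk around (1,1) in Lemma 7.2.) -/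
/-- In a complete nonarchimedean normed field, `1 + 4a` is a nonzero square when `‖a‖ < 1`. The
square root is given by the generating series of the Catalan numbers. -/
theorem exists_sq_eq_one_add_four_mul {K : Type*} [NormedField K] [IsUltrametricDist K]
    [CompleteSpace K] {a : K} (ha : ‖a‖ < 1) : ∃ t : K, t ≠ 0 ∧ t ^ 2 = 1 + 4 * a := by
  let f : ℕ → K := fun n ↦ (catalan n : K) * (-a) ^ n
  have hf : Summable fun n ↦ ‖f n‖ := by
    refine Summable.of_nonneg_of_le (fun _ ↦ norm_nonneg _) (fun n ↦ ?_)
      (summable_geometric_of_lt_one (norm_nonneg a) ha)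
    simp only [f, norm_mul, norm_pow, norm_neg]
    exact mul_le_of_le_one_left (by positivity) (IsUltrametricDist.norm_natCast_le_one K _)
  have hC : ∑' n, f n = 1 + -a * ((∑' n, f n) * ∑' n, f n) := by
    rw [tsum_mul_tsum_eq_tsum_sum_antidiagonal_of_summable_norm hf hf, ← tsum_mul_left,
      hf.of_norm.tsum_eq_zero_add]
    congr 1
    · simp [f]
    · refine tsum_congr fun n ↦ ?_
      simp only [f, catalan_succ', Nat.cast_sum, Nat.cast_mul, Finset.sum_mul, Finset.mul_sum]
      refine Finset.sum_congr rfl fun p hp ↦ ?_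
      rw [← Finset.HasAntidiagonal.mem_antidiagonal.mp hp]
      ring
  have hsq : (1 + 2 * (a * ∑' n, f n)) ^ 2 = 1 + 4 * a := by linear_combination 4 * a * hC
  refine ⟨_, fun h ↦ ?_, hsq⟩
  rw [h, zero_pow two_ne_zero] at hsq
  have h4 : ‖(4 : K) * a‖ < 1 := by
    rw [norm_mul]
    have h4' : ‖(4 : K)‖ ≤ 1 := by
      simpa using IsUltrametricDist.norm_natCast_le_one K 4
    nlinarith [norm_nonneg a]
  rw [show (4 : K) * a = -1 by linear_combination -hsq, norm_neg, norm_one] at h4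
  exact lt_irrefl _ h4

/-- The norm of `1 + x` is `1` when `‖x‖ < 1`. -/
theorem norm_one_add_of_norm_lt_one {K : Type*} [NormedField K] [IsUltrametricDist K] {x : K}
    (hx : ‖x‖ < 1) : ‖1 + x‖ = 1 := by
  have h : ‖(1 : K)‖ ≠ ‖x‖ := by rw [norm_one]; exact hx.ne'
  rw [IsUltrametricDist.norm_add_eq_max_of_norm_ne_norm h, norm_one, max_eq_left hx.le]

/-- Elements differing by `4cw` from `1 + x`, where `x` and `w` are topologically nilpotent and `c`
is integral, lie in the square class of `1 + x`. -/
theorem exists_add_four_mul_eq_sq_mul {K : Type*} [NormedField K] [IsUltrametricDist K]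
    [CompleteSpace K] {x c w : K} (hx : ‖x‖ < 1) (hc : ‖c‖ ≤ 1) (hw : ‖w‖ < 1) :
    ∃ t : K, t ≠ 0 ∧ 1 + x + 4 * (c * w) = t ^ 2 * (1 + x) := by
  have h1 := norm_one_add_of_norm_lt_one hx
  have hne : 1 + x ≠ 0 := norm_ne_zero_iff.mp (by rw [h1]; exact one_ne_zero)
  obtain ⟨t, ht, hsq⟩ := exists_sq_eq_one_add_four_mul (a := c * w / (1 + x)) (by
    rw [norm_div, h1, div_one, norm_mul]
    nlinarith [norm_nonneg w])
  refine ⟨t, ht, ?_⟩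
  rw [hsq]
  field_simp

/-- Every 2-adic unit is congruent to `1` modulo `2`. -/
theorem PadicInt.exists_unit_eq_one_add_two_mul (u : ℤ_[2]ˣ) :
    ∃ w : ℤ_[2], (u : ℤ_[2]) = 1 + 2 * w := by
  have hu : PadicInt.toZMod (u : ℤ_[2]) = 1 := by
    have h : ∀ z : ZMod 2, z ≠ 0 → z = 1 := by decide
    exact h _ (u.isUnit.map PadicInt.toZMod).ne_zero
  have hmem : (u : ℤ_[2]) - 1 ∈ RingHom.ker (PadicInt.toZMod : ℤ_[2] →+* ZMod 2) := by
    rw [RingHom.mem_ker, map_sub, hu, map_one, sub_self]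
  rw [PadicInt.ker_toZMod, PadicInt.maximalIdeal_eq_span_p, Ideal.mem_span_singleton] at hmem
  obtain ⟨w, hw⟩ := hmem
  exact ⟨w, by push_cast at hw; linear_combination hw⟩

/-- Square-class computations for the residue disk around `(1,1)` (Lemma 7.2): in
`L₂ = ℚ₂(2^{1/l})` with `λ^l = 2`:
(1) for every 2-adic unit `u`, `1 + 2u + λ⁻² = s²·(1 + λ² + λ^{l+2})` for some `s ∈ L₂^×`;
(2) for every `u ∈ ℤ₂`, `1 + 4u + λ⁻² = s²·(1 + λ²)` for some `s ∈ L₂^×`. -/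
theorem stmt11 (l : ℕ) (hl : 3 ≤ l) (hodd : Odd l)
    (L₂ : Type*) [Field L₂] [Algebra ℚ_[2] L₂]
    (lam : L₂) (hlam : lam ^ l = 2) (hdeg : Module.finrank ℚ_[2] L₂ = l) :
    (∀ u : ℤ_[2]ˣ, ∃ s : L₂, s ≠ 0 ∧
      1 + 2 * algebraMap ℚ_[2] L₂ (((u : ℤ_[2]) : ℚ_[2])) + (lam⁻¹) ^ 2 =
        s ^ 2 * (1 + lam ^ 2 + lam ^ (l + 2))) ∧
    (∀ u : ℤ_[2], ∃ s : L₂, s ≠ 0 ∧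
      1 + 4 * algebraMap ℚ_[2] L₂ ((u : ℚ_[2])) + (lam⁻¹) ^ 2 =
        s ^ 2 * (1 + lam ^ 2)) := by
  have : FiniteDimensional ℚ_[2] L₂ := Module.finite_of_finrank_pos (by omega)
  let : NormedField L₂ := spectralNorm.normedField ℚ_[2] L₂
  have : CompleteSpace L₂ := spectralNorm.completeSpace ℚ_[2] L₂
  have : IsUltrametricDist L₂ :=
    IsUltrametricDist.isUltrametricDist_of_isNonarchimedean_norm isNonarchimedean_spectralNorm
  have hnorm (x : ℚ_[2]) : ‖algebraMap ℚ_[2] L₂ x‖ = ‖x‖ := spectralNorm_extends x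
  have hint (w : ℤ_[2]) : ‖algebraMap ℚ_[2] L₂ (w : ℚ_[2])‖ ≤ 1 := by
    rw [hnorm]
    exact w.2
  have htwo : ‖(2 : L₂)‖ < 1 := by
    rw [← map_ofNat (algebraMap ℚ_[2] L₂) 2, hnorm]
    exact_mod_cast Padic.norm_p_lt_one (p := 2)
  have hlt : ‖lam‖ < 1 := by
    by_contra! h
    rw [← hlam, norm_pow] at htwo
    exact (one_le_pow₀ h).not_gt htwo
  have hlt2 : ‖lam ^ 2‖ < 1 := by
    rw [norm_pow]
    exact pow_lt_one₀ (norm_nonneg _) hlt two_ne_zero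
  have h2 : (2 : L₂) ≠ 0 := by
    rw [← map_ofNat (algebraMap ℚ_[2] L₂) 2]
    exact (map_ne_zero _).mpr two_ne_zero
  have hlam0 : lam ≠ 0 := by
    rintro rfl
    exact h2 (by rw [← hlam, zero_pow (by omega)])
  constructor
  · intro u
    obtain ⟨w, hw⟩ := PadicInt.exists_unit_eq_one_add_two_mul u
    have hx : ‖lam ^ 2 + lam ^ (l + 2)‖ < 1 := by
      refine (IsUltrametricDist.norm_add_le_max _ _).trans_lt (max_lt hlt2 ?_)
      rw [norm_pow]
      exact pow_lt_one₀ (norm_nonneg _) hlt (by omega)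
    obtain ⟨t, ht, hsq⟩ := exists_add_four_mul_eq_sq_mul hx (hint w) hlt2
    refine ⟨t * lam⁻¹, mul_ne_zero ht (inv_ne_zero hlam0), ?_⟩
    rw [← add_assoc] at hsq
    rw [mul_pow, mul_right_comm, ← hsq, pow_add, hlam, hw, PadicInt.coe_add, PadicInt.coe_mul,
      PadicInt.coe_one, show ((2 : ℤ_[2]) : ℚ_[2]) = 2 from rfl]
    simp only [map_add, map_mul, map_one, map_ofNat]
    field_simp
    ring
  · intro u
    obtain ⟨t, ht, hsq⟩ := exists_add_four_mul_eq_sq_mul hlt2 (hint u) hlt2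
    refine ⟨t * lam⁻¹, mul_ne_zero ht (inv_ne_zero hlam0), ?_⟩
    rw [mul_pow, mul_right_comm, ← hsq]
    field_simp
    ring
end

section
/- Let (c_n)_{n ≥ 1} be a sequence in ℤ₂ and let t ∈ ℤ₂ with v₂(t) = m ≥ 1. Then the series F(t) = Σ_{n≥1} (c_n/n)·t^n and F(2t) = Σ_{n≥1} (c_n/n)·(2t)^n converge in ℚ₂, and v₂(2·F(t) − F(2t)) ≥ 2m. If moreover c_{2n} = 0 for all n ≥ 1 (i.e., the series is odd), then v₂(2·F(t) − F(2t)) ≥ 3m + 1. (This is the power-series computation underlying Lemma 3.4 on 2·i(φ(t)) versus i(φ(2t)), carried out via the formal logarithm.) -/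
/-- The archimedean bound `‖n‖⁻¹ ≤ n` for the `p`-adic norm of a nonzero natural number. -/
theorem Padic.inv_norm_natCast_le {p : ℕ} [Fact p.Prime] {n : ℕ} (hn : n ≠ 0) :
    ‖(n : ℚ_[p])‖⁻¹ ≤ (n : ℝ) := by
  rw [Padic.norm_eq_zpow_neg_valuation (by exact_mod_cast hn), Padic.valuation_natCast,
    zpow_neg, inv_inv, zpow_natCast]
  exact_mod_cast Nat.le_of_dvd (Nat.pos_of_ne_zero hn) pow_padicValNat_dvd

theorem PadicInt.norm_coe_div_mul_pow_le {p : ℕ} [Fact p.Prime] (a : ℤ_[p]) (n : ℕ) (x : ℚ_[p]) :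
    ‖(a : ℚ_[p]) / (n : ℚ_[p]) * x ^ n‖ ≤ ‖(n : ℚ_[p])‖⁻¹ * ‖x‖ ^ n := by
  rw [norm_mul, norm_div, norm_pow, div_eq_mul_inv]
  gcongr
  exact mul_le_of_le_one_left (by positivity) a.norm_le_one

/-- A series `∑ (c n / n) xⁿ` with `p`-adically integral `c n` converges on the open unit disc. -/
theorem PadicInt.summable_coe_div_mul_pow {p : ℕ} [Fact p.Prime] (c : ℕ → ℤ_[p]) {x : ℚ_[p]}
    (hx : ‖x‖ < 1) :
    Summable fun n : ℕ => (c (n + 1) : ℚ_[p]) / ((n + 1 : ℕ) : ℚ_[p]) * x ^ (n + 1) := by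
  have h : Summable fun n : ℕ => (n : ℝ) ^ 1 * ‖x‖ ^ n :=
    summable_pow_mul_geometric_of_norm_lt_one 1 (by simpa using hx)
  refine Summable.of_norm_bounded ((summable_nat_add_iff 1).2 h) fun n => ?_
  refine (norm_coe_div_mul_pow_le _ _ _).trans ?_
  rw [pow_one]
  gcongr
  exact Padic.inv_norm_natCast_le n.succ_ne_zero

theorem Padic.norm_two_mul_sub_le (a : ℤ_[2]) {n : ℕ} (hn : n ≠ 0) (x : ℚ_[2]) :
    ‖2 * ((a : ℚ_[2]) / (n : ℚ_[2]) * x ^ n) - (a : ℚ_[2]) / (n : ℚ_[2]) * (2 * x) ^ n‖ ≤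
      1 / 2 * (‖(n : ℚ_[2])‖⁻¹ * ‖x‖ ^ n) := by
  obtain ⟨k, rfl⟩ := Nat.exists_eq_succ_of_ne_zero hn
  have h2 : ‖(2 : ℚ_[2])‖ = 1 / 2 := by simpa using Padic.norm_p (p := 2)
  have h1 : ‖(1 - 2 ^ k : ℚ_[2])‖ ≤ 1 := by
    exact_mod_cast (1 - 2 ^ k : ℤ_[2]).norm_le_one
  have e : 2 * ((a : ℚ_[2]) / (k.succ : ℚ_[2]) * x ^ k.succ) -
      (a : ℚ_[2]) / (k.succ : ℚ_[2]) * (2 * x) ^ k.succ =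
      2 * ((1 - 2 ^ k) * ((a : ℚ_[2]) / (k.succ : ℚ_[2]) * x ^ k.succ)) := by
    rw [mul_pow, pow_succ 2 k]
    ring
  rw [e, norm_mul, norm_mul, h2]
  refine mul_le_mul_of_nonneg_left ?_ (by norm_num)
  exact (mul_le_of_le_one_left (norm_nonneg _) h1).trans
    (PadicInt.norm_coe_div_mul_pow_le _ _ _)

/-- The power-series computation underlying Lemma 3.4: for `(c_n)` in `ℤ₂` and `t ∈ ℤ₂`
with `v₂(t) = m ≥ 1`, the series `F(t) = Σ_{n ≥ 1} (c_n/n)·tⁿ` and `F(2t)` converge in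
`ℚ₂`, and `v₂(2·F(t) − F(2t)) ≥ 2m` (i.e. `‖2·F(t) − F(2t)‖ ≤ (1/2)^{2m}`); if moreover
`c_{2n} = 0` for all `n ≥ 1`, then `v₂(2·F(t) − F(2t)) ≥ 3m + 1`. -/
theorem stmt15 (c : ℕ → ℤ_[2]) (t : ℤ_[2]) (m : ℕ) (hm : 1 ≤ m)
    (ht : t.valuation = (m : ℤ)) :
    ∃ Ft F2t : ℚ_[2],
      HasSum (fun n : ℕ => ((c (n + 1) : ℚ_[2]) / ((n + 1 : ℕ) : ℚ_[2])) *
        ((t : ℚ_[2]) ^ (n + 1))) Ft ∧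
      HasSum (fun n : ℕ => ((c (n + 1) : ℚ_[2]) / ((n + 1 : ℕ) : ℚ_[2])) *
        ((2 * (t : ℚ_[2])) ^ (n + 1))) F2t ∧
      ‖2 * Ft - F2t‖ ≤ (1 / 2 : ℝ) ^ (2 * m) ∧
      ((∀ n : ℕ, 1 ≤ n → c (2 * n) = 0) → ‖2 * Ft - F2t‖ ≤ (1 / 2 : ℝ) ^ (3 * m + 1)) := by
  have ht0 : t ≠ 0 := by
    rintro rfl
    simp at ht
    omega
  have hx : ‖(t : ℚ_[2])‖ = (1 / 2 : ℝ) ^ m := by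
    rw [PadicInt.padic_norm_e_of_padicInt, PadicInt.norm_eq_zpow_neg_valuation ht0, ht, zpow_neg,
      zpow_natCast]
    simp
  have h2 : ‖(2 : ℚ_[2])‖ = 1 / 2 := by simpa using Padic.norm_p (p := 2)
  have hx1 : ‖(t : ℚ_[2])‖ < 1 := by
    rw [hx]
    exact pow_lt_one₀ (by norm_num) (by norm_num) (by omega)
  have hx2 : ‖2 * (t : ℚ_[2])‖ < 1 := by
    rw [norm_mul, h2]
    linarith [norm_nonneg (t : ℚ_[2])]
  have hF := (PadicInt.summable_coe_div_mul_pow c hx1).hasSum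
  have hF2 := (PadicInt.summable_coe_div_mul_pow c hx2).hasSum
  refine ⟨_, _, hF, hF2, ?_, fun hodd => ?_⟩
  all_goals
    rw [← ((hF.mul_left 2).sub hF2).tsum_eq]
    refine IsUltrametricDist.norm_tsum_le_of_forall_le_of_nonneg (by positivity) fun n => ?_
  · rcases n with _ | k
    · simp [mul_left_comm]
    refine (Padic.norm_two_mul_sub_le _ (Nat.succ_ne_zero _) _).trans ?_
    have hk : ‖((k + 1 + 1 : ℕ) : ℚ_[2])‖⁻¹ ≤ 2 ^ (k + 1) :=
      (Padic.inv_norm_natCast_le (Nat.succ_ne_zero _)).trans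
        (by exact_mod_cast (k + 1).lt_two_pow_self)
    calc 1 / 2 * (‖((k + 1 + 1 : ℕ) : ℚ_[2])‖⁻¹ * ‖(t : ℚ_[2])‖ ^ (k + 1 + 1))
        ≤ 1 / 2 * (2 ^ (k + 1) * ((1 / 2) ^ (m * k) * (1 / 2) ^ (2 * m))) := by
          rw [hx, ← pow_mul, ← pow_add, show m * (k + 1 + 1) = m * k + 2 * m by ring]
          gcongr
      _ ≤ 1 / 2 * (2 ^ (k + 1) * ((1 / 2) ^ k * (1 / 2) ^ (2 * m))) := by
          gcongr 1 / 2 * (2 ^ (k + 1) * (?_ * (1 / 2) ^ (2 * m)))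
          exact pow_le_pow_of_le_one (by norm_num) (by norm_num) (Nat.le_mul_of_pos_left k hm)
      _ = (1 / 2) ^ (2 * m) := by
          have : (2 : ℝ) ^ k * (1 / 2) ^ k = 1 := by rw [← mul_pow]; norm_num
          linear_combination (1 / 2 : ℝ) ^ (2 * m) * this
  · rcases Nat.even_or_odd' n with ⟨k, rfl | rfl⟩
    · rcases k with _ | k
      · simp [mul_left_comm]
      refine (Padic.norm_two_mul_sub_le _ (Nat.succ_ne_zero _) _).trans ?_
      have hn : ‖((2 * (k + 1) + 1 : ℕ) : ℚ_[2])‖ = 1 :=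
        Padic.norm_natCast_eq_one_iff.2 (by simp)
      rw [hn, hx, ← pow_mul, inv_one, one_mul, ← pow_succ']
      refine pow_le_pow_of_le_one (by norm_num) (by norm_num) ?_
      nlinarith [Nat.zero_le (m * k)]
    · rw [show 2 * k + 1 + 1 = 2 * (k + 1) by ring, hodd (k + 1) (by omega)]
      simp
end

section
/- In the setting of the halving data (k, f, g, c, a, d, a₁, f₁, b, s): the system of congruences v·d ≡ w·s (mod f₁), v·d ≡ u·b (mod a₁), u·f₁ ≡ w·s (mod d) has a solution (u, v, w) ∈ k[x]³ with (u, v, w) ≠ (0, 0, 0) satisfying the degree bounds 2·deg(u) < deg(a), 2·deg(v) ≤ 2g + deg(a) − 2·deg(d), deg(w) ≤ g. Moreover, in every such nontrivial solution one has w ≠ 0 (so after scaling, w can be taken monic). -/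
open Polynomial

/-- A 'solution' of the system of congruences of Proposition 5.1: `(u, v, w)` satisfies
`v·d ≡ w·s (mod f₁)`, `v·d ≡ u·b (mod a₁)`, `u·f₁ ≡ w·s (mod d)` together with the degree
bounds `2·deg(u) < deg(a)`, `2·deg(v) ≤ 2g + deg(a) − 2·deg(d)`, `deg(w) ≤ g`
(with `deg 0 = −∞`, the middle bound being stated in the equivalent subtraction-free form
`2·deg(v) + 2·deg(d) ≤ 2g + deg(a)`). -/
def IsHalvingSol {k : Type*} [Field k] (g : ℕ) (a d a₁ f₁ b s u v w : Polynomial k) :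
    Prop :=
  f₁ ∣ v * d - w * s ∧ a₁ ∣ v * d - u * b ∧ d ∣ u * f₁ - w * s ∧
  u.degree + u.degree < a.degree ∧
  v.degree + v.degree + d.degree + d.degree ≤ ((g + g : ℕ) : WithBot ℕ) + a.degree ∧
  w.degree ≤ (g : WithBot ℕ)

/-- Three linear congruences `Aᵢ u + Bᵢ v + Cᵢ w ≡ 0 (mod Mᵢ)` have a nontrivial solution in
polynomials of bounded degree as soon as there are more coefficients than conditions. -/
theorem exists_ne_zero_of_three_congruences {k : Type*} [Field k]
    {M₁ M₂ M₃ : k[X]} (h₁ : M₁ ≠ 0) (h₂ : M₂ ≠ 0) (h₃ : M₃ ≠ 0)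
    (A₁ A₂ A₃ B₁ B₂ B₃ C₁ C₂ C₃ : k[X]) {p q r : ℕ}
    (hlt : M₁.natDegree + M₂.natDegree + M₃.natDegree < p + q + r) :
    ∃ u v w : k[X], ¬ (u = 0 ∧ v = 0 ∧ w = 0) ∧
      M₁ ∣ A₁ * u + B₁ * v + C₁ * w ∧ M₂ ∣ A₂ * u + B₂ * v + C₂ * w ∧
      M₃ ∣ A₃ * u + B₃ * v + C₃ * w ∧ u.degree < p ∧ v.degree < q ∧ w.degree < r := by
  have fin (n : ℕ) : Module.Finite k (degreeLT k n) :=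
    Module.Finite.equiv (degreeLTEquiv k n).symm
  have rk (n : ℕ) : Module.finrank k (degreeLT k n) = n := by
    rw [(degreeLTEquiv k n).finrank_eq, Module.finrank_fin_fun]
  have finA {M : k[X]} (h : M ≠ 0) : Module.Finite k (AdjoinRoot M) :=
    (AdjoinRoot.powerBasis h).finite
  have rkA {M : k[X]} (h : M ≠ 0) : Module.finrank k (AdjoinRoot M) = M.natDegree :=
    (AdjoinRoot.powerBasis h).finrank
  have := fin p
  have := fin q
  have := fin r
  have := finA h₁
  have := finA h₂
  have := finA h₃
  let comb (A B C : k[X]) : (degreeLT k p × degreeLT k q × degreeLT k r) →ₗ[k] k[X] :=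
    (LinearMap.mulLeft k A ∘ₗ (degreeLT k p).subtype).coprod
      ((LinearMap.mulLeft k B ∘ₗ (degreeLT k q).subtype).coprod
        (LinearMap.mulLeft k C ∘ₗ (degreeLT k r).subtype))
  let φ : (degreeLT k p × degreeLT k q × degreeLT k r) →ₗ[k]
      (AdjoinRoot M₁ × AdjoinRoot M₂ × AdjoinRoot M₃) :=
    ((AdjoinRoot.mkₐ M₁).toLinearMap.restrictScalars k ∘ₗ comb A₁ B₁ C₁).prod
      (((AdjoinRoot.mkₐ M₂).toLinearMap.restrictScalars k ∘ₗ comb A₂ B₂ C₂).prod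
        ((AdjoinRoot.mkₐ M₃).toLinearMap.restrictScalars k ∘ₗ comb A₃ B₃ C₃))
  have hker : LinearMap.ker φ ≠ ⊥ := by
    apply LinearMap.ker_ne_bot_of_finrank_lt
    simp only [Module.finrank_prod, rk, rkA h₁, rkA h₂, rkA h₃]
    omega
  obtain ⟨⟨u, v, w⟩, hx, hne⟩ := (Submodule.ne_bot_iff _).1 hker
  obtain ⟨e₁, e₂₃⟩ := Prod.mk_eq_zero.1 (LinearMap.mem_ker.1 hx)
  obtain ⟨e₂, e₃⟩ := Prod.mk_eq_zero.1 e₂₃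
  refine ⟨u, v, w, ?_, ?_, ?_, ?_, mem_degreeLT.1 u.2, mem_degreeLT.1 v.2, mem_degreeLT.1 w.2⟩
  · rintro ⟨hu, hv, hw⟩
    exact hne (by ext1; exacts [Subtype.ext hu, Prod.ext (Subtype.ext hv) (Subtype.ext hw)])
  · have := AdjoinRoot.mk_eq_zero.1 e₁
    simpa [comb, add_assoc] using this
  · have := AdjoinRoot.mk_eq_zero.1 e₂
    simpa [comb, add_assoc] using this
  · have := AdjoinRoot.mk_eq_zero.1 e₃
    simpa [comb, add_assoc] using this

/-- If `f` has odd degree, `f v² = u²` forces `v = 0`. -/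
theorem eq_zero_of_mul_sq_eq_sq_of_odd_natDegree {k : Type*} [Field k] {f u v : k[X]}
    (hf : Odd f.natDegree) (h : f * v ^ 2 = u ^ 2) : v = 0 := by
  by_contra hv
  have hf0 : f ≠ 0 := by
    rintro rfl
    simp at hf
  have := congrArg natDegree h
  rw [natDegree_mul hf0 (pow_ne_zero _ hv), natDegree_pow, natDegree_pow] at this
  obtain ⟨m, hm⟩ := hf
  omega

/-- A halving solution with `w = 0` yields `u` and `t` with `v = f₁ t` and
`a ∣ f t² - u²`. -/
theorem exists_dvd_mul_sq_sub_sq {k : Type*} [Field k] {f a d a₁ f₁ b u v : k[X]}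
    (hf : Squarefree f) (hasf : Squarefree a)
    (hdgcd : ∀ e : k[X], e ∣ a → e ∣ f → e ∣ d)
    (ha₁ : a = d * a₁) (hf₁ : f = d * f₁) (hb : a ∣ f - b ^ 2)
    (h₁ : f₁ ∣ v * d) (h₂ : a₁ ∣ v * d - u * b) (h₃ : d ∣ u * f₁) :
    ∃ t, v = f₁ * t ∧ a ∣ f * t ^ 2 - u ^ 2 := by
  have hdf₁ : IsCoprime d f₁ :=
    isRelPrime_iff_isCoprime.1 (squarefree_mul_iff.1 (hf₁ ▸ hf)).1
  have hda₁ : IsCoprime d a₁ :=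
    isRelPrime_iff_isCoprime.1 (squarefree_mul_iff.1 (ha₁ ▸ hasf)).1
  have hdsq : Squarefree d := (squarefree_mul_iff.1 (hf₁ ▸ hf)).2.1
  obtain ⟨t, rfl⟩ := hdf₁.symm.dvd_of_dvd_mul_right h₁
  have hdu : d ∣ u := hdf₁.dvd_of_dvd_mul_right h₃
  have ha₁a : a₁ ∣ a := ⟨d, by rw [ha₁, mul_comm]⟩
  have hba₁ : IsCoprime a₁ b := by
    refine isRelPrime_iff_isCoprime.1 fun e hea heb => ?_
    have hef : e ∣ f := by
      have := dvd_add ((hea.trans ha₁a).trans hb) (heb.trans (dvd_pow_self b two_ne_zero))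
      rwa [sub_add_cancel] at this
    exact hda₁.isUnit_of_dvd' (hdgcd e (hea.trans ha₁a) hef) hea
  have hdb : d ∣ b := by
    refine (hdsq.dvd_pow_iff_dvd two_ne_zero).1 ?_
    have := dvd_sub (Dvd.intro _ hf₁.symm : d ∣ f) ((Dvd.intro _ ha₁.symm : d ∣ a).trans hb)
    rwa [sub_sub_cancel] at this
  have hda : a ∣ b * t - u := by
    rw [ha₁]
    refine hda₁.mul_dvd (dvd_sub (hdb.mul_right t) hdu) (hba₁.dvd_of_dvd_mul_left ?_)
    have : b * (b * t - u) = (f₁ * t * d - u * b) - (f - b ^ 2) * t := by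
      rw [hf₁]; ring
    rw [this]
    exact dvd_sub h₂ ((ha₁a.trans hb).mul_right t)
  refine ⟨t, rfl, ?_⟩
  have : f * t ^ 2 - u ^ 2 = (f - b ^ 2) * t ^ 2 + (b * t - u) * (b * t + u) := by ring
  rw [this]
  exact dvd_add (hb.mul_right _) (hda.mul_right _)

/-- Proposition 5.1, existence part: the system of congruences has a nontrivial solution
`(u, v, w)` within the stated degree bounds, and every nontrivial solution has `w ≠ 0`. -/
theorem stmt16 (k : Type*) [Field k] (hchar : (2 : k) ≠ 0)
    (g : ℕ) (f : Polynomial k) (hf : Squarefree f) (hfdeg : f.natDegree = 2 * g + 1)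
    (c : k) (hc : f.leadingCoeff = c)
    (a : Polynomial k) (ham : a.Monic) (hasf : Squarefree a)
    (hadeg : a.natDegree ≤ 2 * g + 1)
    (d a₁ f₁ : Polynomial k) (hdm : d.Monic) (hda : d ∣ a) (hdf : d ∣ f)
    (hdgcd : ∀ e : Polynomial k, e ∣ a → e ∣ f → e ∣ d)
    (ha₁ : a = d * a₁) (hf₁ : f = d * f₁)
    (b s : Polynomial k) (hb : a ∣ f - b ^ 2)
    (hs : f ∣ Polynomial.C ((-c) ^ a.natDegree) * (a - a₁ * f₁) - s ^ 2) :
    (∃ u v w : Polynomial k, ¬ (u = 0 ∧ v = 0 ∧ w = 0) ∧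
      IsHalvingSol g a d a₁ f₁ b s u v w) ∧
    (∀ u v w : Polynomial k, IsHalvingSol g a d a₁ f₁ b s u v w →
      ¬ (u = 0 ∧ v = 0 ∧ w = 0) → w ≠ 0) := by
  have hf0 : f ≠ 0 := hf.ne_zero
  have ha0 : a ≠ 0 := ham.ne_zero
  have hd0 : d ≠ 0 := hdm.ne_zero
  have ha₁0 : a₁ ≠ 0 := by
    rintro rfl
    exact ha0 (by simpa using ha₁)
  have hf₁0 : f₁ ≠ 0 := by
    rintro rfl
    exact hf0 (by simpa using hf₁)
  have hdega : a.natDegree = d.natDegree + a₁.natDegree := by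
    rw [ha₁, natDegree_mul hd0 ha₁0]
  have hdegf : 2 * g + 1 = d.natDegree + f₁.natDegree := by
    rw [← hfdeg, hf₁, natDegree_mul hd0 hf₁0]
  constructor
  · obtain ⟨u, v, w, hne, e₁, e₂, e₃, hu, hv, hw⟩ :=
      exists_ne_zero_of_three_congruences hf₁0 ha₁0 hd0 0 (-b) f₁ d d 0 (-s) 0 (-s)
        (p := (a.natDegree + 1) / 2) (q := g + a.natDegree / 2 + 1 - d.natDegree)
        (r := g + 1) (by omega)
    refine ⟨u, v, w, hne, ?_, ?_, ?_, ?_, ?_, ?_⟩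
    · convert e₁ using 1; ring
    · convert e₂ using 1; ring
    · convert e₃ using 1; ring
    · rcases eq_or_ne u 0 with rfl | hu0
      · simpa [bot_lt_iff_ne_bot] using ha0
      · rw [degree_eq_natDegree hu0] at hu ⊢
        rw [degree_eq_natDegree ha0]
        norm_cast at hu ⊢
        omega
    · rcases eq_or_ne v 0 with rfl | hv0
      · simp
      · rw [degree_eq_natDegree hv0] at hv ⊢
        rw [degree_eq_natDegree ha0, degree_eq_natDegree hd0]
        norm_cast at hv ⊢
        omega
    · rcases eq_or_ne w 0 with rfl | hw0
      · simp
      · rw [degree_eq_natDegree hw0] at hw ⊢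
        norm_cast at hw ⊢
        omega
  · rintro u v w ⟨h₁, h₂, h₃, hu, hv, -⟩ hne rfl
    simp only [zero_mul, sub_zero] at h₁ h₃
    obtain ⟨t, rfl, hdvd⟩ := exists_dvd_mul_sq_sub_sq hf hasf hdgcd ha₁ hf₁ hb h₁ h₂ h₃
    have hlt₁ : (f * t ^ 2).degree < a.degree := by
      rcases eq_or_ne t 0 with rfl | ht
      · simpa [bot_lt_iff_ne_bot] using ha0
      · rw [degree_eq_natDegree (mul_ne_zero hf₁0 ht), degree_eq_natDegree ha0,
          degree_eq_natDegree hd0, natDegree_mul hf₁0 ht] at hv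
        rw [degree_eq_natDegree (mul_ne_zero hf0 (pow_ne_zero 2 ht)), degree_eq_natDegree ha0,
          natDegree_mul hf0 (pow_ne_zero 2 ht), natDegree_pow, hfdeg]
        norm_cast at hv ⊢
        omega
    have hlt₂ : (u ^ 2).degree < a.degree := by
      rwa [sq, degree_mul]
    have heq : f * t ^ 2 = u ^ 2 := sub_eq_zero.1 <|
      eq_zero_of_dvd_of_degree_lt hdvd
        ((degree_sub_le _ _).trans_lt (max_lt hlt₁ hlt₂))
    have ht : t = 0 := eq_zero_of_mul_sq_eq_sq_of_odd_natDegree ⟨g, hfdeg⟩ heq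
    subst ht
    exact hne ⟨by simpa using heq.symm, by simp, rfl⟩
end

section
/- In the setting of the halving data (k, f, g, c, a, d, a₁, f₁, b, s): every triple (u, v, w) ∈ k[x]³ satisfying the congruences v·d ≡ w·s (mod f₁), v·d ≡ u·b (mod a₁), u·f₁ ≡ w·s (mod d) and the degree bounds 2·deg(u) < deg(a), 2·deg(v) ≤ 2g + deg(a) − 2·deg(d), deg(w) ≤ g satisfies the polynomial identity u²·f₁ = d·v² − (−c)^{deg(a)}·a₁·w². -/
open Polynomial

/-- The norm form `d·v² − E·a₁·w² − u²·f₁` of a solution is divisible by `a₁·f₁·d`. -/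
theorem IsHalvingSol.mul_dvd {k : Type*} [Field k] {g : ℕ} {f a d a₁ f₁ b s u v w E : k[X]}
    (hf : Squarefree f) (hasf : Squarefree a)
    (hdgcd : ∀ e : k[X], e ∣ a → e ∣ f → e ∣ d) (ha₁ : a = d * a₁) (hf₁ : f = d * f₁)
    (hb : a ∣ f - b ^ 2) (hs : f ∣ E * (a - a₁ * f₁) - s ^ 2)
    (h : IsHalvingSol g a d a₁ f₁ b s u v w) :
    a₁ * f₁ * d ∣ d * v ^ 2 - E * (a₁ * w ^ 2) - u ^ 2 * f₁ := by
  obtain ⟨⟨p, hp⟩, ⟨q, hq⟩, ⟨r, hr⟩, -⟩ := h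
  obtain ⟨m, hm⟩ := hb
  obtain ⟨n, hn⟩ := hs
  subst ha₁ hf₁
  have cda : IsCoprime a₁ d := (IsRelPrime.isCoprime (squarefree_mul_iff.1 hasf).1).symm
  have cdf : IsCoprime f₁ d := (IsRelPrime.isCoprime (squarefree_mul_iff.1 hf).1).symm
  have caf : IsCoprime a₁ f₁ := by
    refine IsRelPrime.isCoprime fun e he he' => ?_
    exact cda.isRelPrime he (hdgcd e (he.mul_left d) (he'.mul_left d))
  refine (IsCoprime.mul_left cda cdf).mul_dvd (caf.mul_dvd ?_ ?_) ?_
  · refine cda.dvd_of_dvd_mul_left ⟨q * (v * d + u * b) - d * E * w ^ 2 - d * u ^ 2 * m, ?_⟩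
    linear_combination (v * d + u * b) * hq - u ^ 2 * hm
  · refine cdf.dvd_of_dvd_mul_left
      ⟨p * (v * d + w * s) - d * u ^ 2 - E * a₁ * w ^ 2 - w ^ 2 * d * n, ?_⟩
    linear_combination (v * d + w * s) * hp - w ^ 2 * hn
  · refine cdf.symm.dvd_of_dvd_mul_left
      ⟨f₁ * v ^ 2 - r * (u * f₁ + w * s) - E * a₁ * w ^ 2 + w ^ 2 * f₁ * n, ?_⟩
    linear_combination -(u * f₁ + w * s) * hr + w ^ 2 * hn

/-- The norm form of a solution has degree smaller than `a₁·f₁·d`. -/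
theorem IsHalvingSol.degree_lt {k : Type*} [Field k] {g : ℕ} {f a d a₁ f₁ b s u v w : k[X]}
    {e : k} (hfdeg : f.natDegree = 2 * g + 1) (ha : a ≠ 0)
    (ha₁ : a = d * a₁) (hf₁ : f = d * f₁) (h : IsHalvingSol g a d a₁ f₁ b s u v w) :
    (d * v ^ 2 - C e * (a₁ * w ^ 2) - u ^ 2 * f₁).degree < (a₁ * f₁ * d).degree := by
  obtain ⟨-, -, -, hu, hv, hw⟩ := h
  have hf : f ≠ 0 := by rintro rfl; simp at hfdeg
  have hd0 : d ≠ 0 := by rintro rfl; simp_all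
  have ha0 : a₁ ≠ 0 := by rintro rfl; simp_all
  have hf0 : f₁ ≠ 0 := by rintro rfl; simp_all
  have hF : 2 * g + 1 = d.natDegree + f₁.natDegree := by
    rw [← hfdeg, hf₁, natDegree_mul hd0 hf0]
  have hA : a.degree = ((d.natDegree + a₁.natDegree : ℕ) : WithBot ℕ) := by
    rw [degree_eq_natDegree ha, ha₁, natDegree_mul hd0 ha0]
  have hM : (a₁ * f₁ * d).degree =
      ((a₁.natDegree + f₁.natDegree + d.natDegree : ℕ) : WithBot ℕ) := by
    simp only [degree_mul, degree_eq_natDegree hd0, degree_eq_natDegree ha0,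
      degree_eq_natDegree hf0, Nat.cast_add]
  rw [hA] at hu hv
  rw [hM]
  refine (degree_sub_le _ _).trans_lt (max_lt ((degree_sub_le _ _).trans_lt (max_lt ?_ ?_)) ?_)
  · rcases eq_or_ne v 0 with rfl | hv0
    · simp
    rw [degree_eq_natDegree hv0, degree_eq_natDegree hd0] at hv
    rw [degree_mul, degree_pow, degree_eq_natDegree hv0, degree_eq_natDegree hd0, two_nsmul]
    norm_cast at hv ⊢
    omega
  · rw [C_mul']
    refine (degree_smul_le e _).trans_lt ?_
    rcases eq_or_ne w 0 with rfl | hw0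
    · simp
    rw [degree_eq_natDegree hw0] at hw
    rw [degree_mul, degree_pow, degree_eq_natDegree hw0, degree_eq_natDegree ha0, two_nsmul]
    norm_cast at hw ⊢
    omega
  · rcases eq_or_ne u 0 with rfl | hu0
    · simp
    rw [degree_eq_natDegree hu0] at hu
    rw [degree_mul, degree_pow, degree_eq_natDegree hu0, degree_eq_natDegree hf0, two_nsmul]
    norm_cast at hu ⊢
    omega

/-- Proposition 5.1, the key identity: every solution `(u, v, w)` of the system of
congruences within the degree bounds satisfies `u²·f₁ = d·v² − (−c)^{deg a}·a₁·w²`. -/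
theorem stmt17 (k : Type*) [Field k] (hchar : (2 : k) ≠ 0)
    (g : ℕ) (f : Polynomial k) (hf : Squarefree f) (hfdeg : f.natDegree = 2 * g + 1)
    (c : k) (hc : f.leadingCoeff = c)
    (a : Polynomial k) (ham : a.Monic) (hasf : Squarefree a)
    (hadeg : a.natDegree ≤ 2 * g + 1)
    (d a₁ f₁ : Polynomial k) (hdm : d.Monic) (hda : d ∣ a) (hdf : d ∣ f)
    (hdgcd : ∀ e : Polynomial k, e ∣ a → e ∣ f → e ∣ d)
    (ha₁ : a = d * a₁) (hf₁ : f = d * f₁)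
    (b s : Polynomial k) (hb : a ∣ f - b ^ 2)
    (hs : f ∣ Polynomial.C ((-c) ^ a.natDegree) * (a - a₁ * f₁) - s ^ 2) :
    ∀ u v w : Polynomial k, IsHalvingSol g a d a₁ f₁ b s u v w →
      u ^ 2 * f₁ = d * v ^ 2 - Polynomial.C ((-c) ^ a.natDegree) * (a₁ * w ^ 2) := by
  intro u v w h
  have h0 := eq_zero_of_dvd_of_degree_lt (h.mul_dvd hf hasf hdgcd ha₁ hf₁ hb hs)
    (h.degree_lt hfdeg ham.ne_zero ha₁ hf₁)
  exact (sub_eq_zero.1 h0).symm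
end

section
/- In the setting of the halving data (k, f, g, c, a, d, a₁, f₁, b, s): if (u, v, w) and (u′, v′, w) are two solutions of the system with the same component w ≠ 0, then u = u′ and v = v′. Consequently, there is exactly one solution (u, v, w) in which w is monic of minimal degree among the w-components of all nontrivial solutions. -/
open Polynomial

namespace IsHalvingSol

variable {k : Type*} [Field k] {g : ℕ} {a d a₁ f₁ b s u v w u' v' w' : k[X]}

theorem sub (h : IsHalvingSol g a d a₁ f₁ b s u v w)
    (h' : IsHalvingSol g a d a₁ f₁ b s u' v' w') :
    IsHalvingSol g a d a₁ f₁ b s (u - u') (v - v') (w - w') := by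
  obtain ⟨h1, h2, h3, hu, hv, hw⟩ := h
  obtain ⟨h1', h2', h3', hu', hv', hw'⟩ := h'
  refine ⟨?_, ?_, ?_, ?_, ?_, (degree_sub_le _ _).trans (max_le hw hw')⟩
  · convert dvd_sub h1 h1' using 1; ring
  · convert dvd_sub h2 h2' using 1; ring
  · convert dvd_sub h3 h3' using 1; ring
  · have h := degree_sub_le u u'
    rcases max_choice u.degree u'.degree with e | e <;> rw [e] at h
    · exact (add_le_add h h).trans_lt hu
    · exact (add_le_add h h).trans_lt hu'
  · have h := degree_sub_le v v'
    rcases max_choice v.degree v'.degree with e | e <;> rw [e] at h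
    · exact le_trans (by gcongr) hv
    · exact le_trans (by gcongr) hv'

theorem C_mul (h : IsHalvingSol g a d a₁ f₁ b s u v w) {r : k} (hr : r ≠ 0) :
    IsHalvingSol g a d a₁ f₁ b s (C r * u) (C r * v) (C r * w) := by
  obtain ⟨h1, h2, h3, hu, hv, hw⟩ := h
  simp only [IsHalvingSol, degree_C_mul hr]
  refine ⟨?_, ?_, ?_, hu, hv, hw⟩
  · convert h1.mul_left (C r) using 1; ring
  · convert h2.mul_left (C r) using 1; ring
  · convert h3.mul_left (C r) using 1; ring

/-- A solution with `w = 0` satisfies `u² f₁ = v² d`, hence vanishes, because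
`deg (d * f₁)` is odd. -/
theorem eq_zero (hf : Squarefree (d * f₁)) (hfdeg : (d * f₁).natDegree = 2 * g + 1)
    (ha : Squarefree (d * a₁)) (hcop : IsCoprime a₁ f₁)
    (hb : d * a₁ ∣ d * f₁ - b ^ 2)
    (h : IsHalvingSol g (d * a₁) d a₁ f₁ b s u v 0) : u = 0 ∧ v = 0 := by
  have hd0 : d ≠ 0 := fun h0 => hf.ne_zero (by simp [h0])
  have hf0 : f₁ ≠ 0 := fun h0 => hf.ne_zero (by simp [h0])
  have ha0 : a₁ ≠ 0 := fun h0 => ha.ne_zero (by simp [h0])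
  have hdf : IsCoprime d f₁ := (squarefree_mul_iff.1 hf).1.isCoprime
  have hda : IsCoprime d a₁ := (squarefree_mul_iff.1 ha).1.isCoprime
  rw [natDegree_mul hd0 hf0] at hfdeg
  obtain ⟨h1, h2, h3, hu, hv, -⟩ := h
  simp only [zero_mul, sub_zero] at h1 h3
  have hf₁v : f₁ ∣ v := hdf.symm.dvd_of_dvd_mul_right h1
  have hdu : d ∣ u := hdf.dvd_of_dvd_mul_right h3
  have ha₁ : a₁ ∣ u ^ 2 * f₁ - v ^ 2 * d := by
    refine hda.symm.dvd_of_dvd_mul_left (?_ : a₁ ∣ d * _)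
    have hb' := ((dvd_mul_left a₁ d).trans hb).mul_left (u ^ 2)
    convert dvd_sub hb' (h2.mul_left (v * d + u * b)) using 1
    ring
  have hdvd : f₁ * d * a₁ ∣ u ^ 2 * f₁ - v ^ 2 * d := by
    refine IsCoprime.mul_dvd (IsCoprime.mul_left hcop.symm hda)
      (hdf.symm.mul_dvd ?_ ?_) ha₁
    · exact dvd_sub (dvd_mul_left _ _) ((hf₁v.trans (dvd_pow_self v two_ne_zero)).mul_right d)
    · exact dvd_sub ((hdu.trans (dvd_pow_self u two_ne_zero)).mul_right f₁) (dvd_mul_left _ _)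
  have hu' : u ≠ 0 → 2 * u.natDegree < d.natDegree + a₁.natDegree := fun h0 => by
    rw [degree_mul, degree_eq_natDegree h0, degree_eq_natDegree hd0,
      degree_eq_natDegree ha0] at hu
    norm_cast at hu
    omega
  have hv' : v ≠ 0 → 2 * v.natDegree + d.natDegree ≤ 2 * g + a₁.natDegree := fun h0 => by
    rw [degree_mul, degree_eq_natDegree h0, degree_eq_natDegree hd0,
      degree_eq_natDegree ha0] at hv
    norm_cast at hv
    omega
  have heq : u ^ 2 * f₁ - v ^ 2 * d = 0 := by
    refine eq_zero_of_dvd_of_degree_lt hdvd ((degree_sub_le _ _).trans_lt (max_lt ?_ ?_))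
    · by_cases h0 : u = 0
      · simp [h0, bot_lt_iff_ne_bot, hd0, hf0, ha0]
      · have := hu' h0
        simp only [degree_mul, degree_pow, degree_eq_natDegree h0, degree_eq_natDegree hd0,
          degree_eq_natDegree ha0, degree_eq_natDegree hf0, nsmul_eq_mul]
        norm_cast
        omega
    · by_cases h0 : v = 0
      · simp [h0, bot_lt_iff_ne_bot, hd0, hf0, ha0]
      · have := hv' h0
        simp only [degree_mul, degree_pow, degree_eq_natDegree h0, degree_eq_natDegree hd0,
          degree_eq_natDegree ha0, degree_eq_natDegree hf0, nsmul_eq_mul]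
        norm_cast
        omega
  rw [sub_eq_zero] at heq
  by_cases hu0 : u = 0
  · simp_all
  · by_cases hv0 : v = 0
    · simp_all
    · have := congrArg natDegree heq
      rw [natDegree_mul (pow_ne_zero 2 hu0) hf0, natDegree_mul (pow_ne_zero 2 hv0) hd0,
        natDegree_pow, natDegree_pow] at this
      omega

end IsHalvingSol

theorem Polynomial.finite_quotient_span_singleton {k : Type*} [Field k] {p : k[X]}
    (hp : p ≠ 0) : Module.Finite k (k[X] ⧸ Ideal.span {p}) :=
  (AdjoinRoot.powerBasis hp).finite

theorem Polynomial.finite_degreeLT (k : Type*) [Field k] (n : ℕ) :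
    Module.Finite k (degreeLT k n) :=
  Module.Finite.equiv (degreeLTEquiv k n).symm

theorem Polynomial.finrank_degreeLT (k : Type*) [Field k] (n : ℕ) :
    Module.finrank k (degreeLT k n) = n := by
  simpa using (degreeLTEquiv k n).finrank_eq

/-- Three linear congruences on polynomials of bounded degree have a nontrivial solution
as soon as there are more free coefficients than conditions. -/
theorem Polynomial.exists_ne_zero_dvd {k : Type*} [Field k] {p q r : k[X]}
    (hp : p ≠ 0) (hq : q ≠ 0) (hr : r ≠ 0) {l m n : ℕ}
    (hlt : p.natDegree + q.natDegree + r.natDegree < l + m + n)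
    (A B D : k[X] × k[X] × k[X] →ₗ[k] k[X]) :
    ∃ x : k[X] × k[X] × k[X], x ≠ 0 ∧ x.1.degree < l ∧ x.2.1.degree < m ∧ x.2.2.degree < n ∧
      p ∣ A x ∧ q ∣ B x ∧ r ∣ D x := by
  have := finite_quotient_span_singleton hp
  have := finite_quotient_span_singleton hq
  have := finite_quotient_span_singleton hr
  have := finite_degreeLT k l
  have := finite_degreeLT k m
  have := finite_degreeLT k n
  let ι : degreeLT k l × degreeLT k m × degreeLT k n →ₗ[k] k[X] × k[X] × k[X] :=
    (degreeLT k l).subtype.prodMap ((degreeLT k m).subtype.prodMap (degreeLT k n).subtype)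
  let π (t : k[X]) : k[X] →ₗ[k] k[X] ⧸ Ideal.span {t} := (Ideal.Quotient.mkₐ k _).toLinearMap
  let T := (((π p).comp A).prod (((π q).comp B).prod ((π r).comp D))).comp ι
  have hker : LinearMap.ker T ≠ ⊥ := by
    apply LinearMap.ker_ne_bot_of_finrank_lt
    simp only [Module.finrank_prod, finrank_degreeLT, finrank_quotient_span_eq_natDegree]
    omega
  obtain ⟨x, hx, hx0⟩ := Submodule.exists_mem_ne_zero_of_ne_bot hker
  have hx' : π p (A (ι x)) = 0 ∧ π q (B (ι x)) = 0 ∧ π r (D (ι x)) = 0 := by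
    simpa [T] using hx
  have hπ (t y : k[X]) (h : π t y = 0) : t ∣ y := by
    rw [← Ideal.mem_span_singleton]
    exact Ideal.Quotient.eq_zero_iff_mem.1 h
  refine ⟨ι x, fun h0 => hx0 ?_, mem_degreeLT.1 x.1.2, mem_degreeLT.1 x.2.1.2,
    mem_degreeLT.1 x.2.2.2, hπ _ _ hx'.1, hπ _ _ hx'.2.1, hπ _ _ hx'.2.2⟩
  simpa [ι, Prod.ext_iff] using h0

theorem IsHalvingSol.exists_ne_zero {k : Type*} [Field k] {g : ℕ} {d a₁ f₁ : k[X]} (b s : k[X])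
    (hd : d ≠ 0) (ha₁ : a₁ ≠ 0) (hf₁ : f₁ ≠ 0) (hfdeg : (d * f₁).natDegree = 2 * g + 1) :
    ∃ u v w : k[X], IsHalvingSol g (d * a₁) d a₁ f₁ b s u v w ∧ ¬ (u = 0 ∧ v = 0 ∧ w = 0) := by
  rw [natDegree_mul hd hf₁] at hfdeg
  let μ (t : k[X]) : k[X] →ₗ[k] k[X] := LinearMap.mulRight k t
  let U : k[X] × k[X] × k[X] →ₗ[k] k[X] := LinearMap.fst k _ _
  let V : k[X] × k[X] × k[X] →ₗ[k] k[X] := (LinearMap.fst k _ _).comp (LinearMap.snd k _ _)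
  let W : k[X] × k[X] × k[X] →ₗ[k] k[X] := (LinearMap.snd k _ _).comp (LinearMap.snd k _ _)
  obtain ⟨⟨u, v, w⟩, h0, hu, hv, hw, h1, h2, h3⟩ :=
    exists_ne_zero_dvd hf₁ ha₁ hd
      (l := (d.natDegree + a₁.natDegree + 1) / 2)
      (m := g + (d.natDegree + a₁.natDegree) / 2 + 1 - d.natDegree) (n := g + 1)
      (by omega) ((μ d).comp V - (μ s).comp W) ((μ d).comp V - (μ b).comp U)
      ((μ f₁).comp U - (μ s).comp W)
  simp only at hu hv hw
  refine ⟨u, v, w, ⟨h1, h2, h3, ?_, ?_, ?_⟩, by simpa [Prod.ext_iff] using h0⟩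
  · by_cases hu0 : u = 0
    · simp [hu0, bot_lt_iff_ne_bot, hd, ha₁]
    · rw [degree_eq_natDegree hu0] at hu ⊢
      rw [degree_mul, degree_eq_natDegree hd, degree_eq_natDegree ha₁]
      norm_cast at hu ⊢
      omega
  · by_cases hv0 : v = 0
    · simp [hv0]
    · rw [degree_eq_natDegree hv0] at hv ⊢
      rw [degree_mul, degree_eq_natDegree hd, degree_eq_natDegree ha₁]
      norm_cast at hv ⊢
      omega
  · exact Order.lt_succ_iff.1 (by exact_mod_cast hw)

/-- Proposition 5.1, uniqueness part: a solution is determined by its component `w ≠ 0`,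
and there is exactly one solution `(u, v, w)` in which `w` is monic of minimal degree
among the `w`-components of all nontrivial solutions. -/
theorem stmt18 (k : Type*) [Field k] (hchar : (2 : k) ≠ 0)
    (g : ℕ) (f : Polynomial k) (hf : Squarefree f) (hfdeg : f.natDegree = 2 * g + 1)
    (c : k) (hc : f.leadingCoeff = c)
    (a : Polynomial k) (ham : a.Monic) (hasf : Squarefree a)
    (hadeg : a.natDegree ≤ 2 * g + 1)
    (d a₁ f₁ : Polynomial k) (hdm : d.Monic) (hda : d ∣ a) (hdf : d ∣ f)
    (hdgcd : ∀ e : Polynomial k, e ∣ a → e ∣ f → e ∣ d)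
    (ha₁ : a = d * a₁) (hf₁ : f = d * f₁)
    (b s : Polynomial k) (hb : a ∣ f - b ^ 2)
    (hs : f ∣ Polynomial.C ((-c) ^ a.natDegree) * (a - a₁ * f₁) - s ^ 2) :
    (∀ u v u' v' w : Polynomial k, w ≠ 0 →
      IsHalvingSol g a d a₁ f₁ b s u v w → IsHalvingSol g a d a₁ f₁ b s u' v' w →
      u = u' ∧ v = v') ∧
    (∃! uvw : Polynomial k × Polynomial k × Polynomial k,
      IsHalvingSol g a d a₁ f₁ b s uvw.1 uvw.2.1 uvw.2.2 ∧
      ¬ (uvw.1 = 0 ∧ uvw.2.1 = 0 ∧ uvw.2.2 = 0) ∧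
      uvw.2.2.Monic ∧
      ∀ u' v' w' : Polynomial k, IsHalvingSol g a d a₁ f₁ b s u' v' w' →
        ¬ (u' = 0 ∧ v' = 0 ∧ w' = 0) → uvw.2.2.degree ≤ w'.degree) := by
  subst ha₁ hf₁
  have hd0 : d ≠ 0 := hdm.ne_zero
  have hf0 : f₁ ≠ 0 := fun h0 => hf.ne_zero (by simp [h0])
  have ha0 : a₁ ≠ 0 := fun h0 => hasf.ne_zero (by simp [h0])
  have hcop : IsCoprime a₁ f₁ := by
    refine IsRelPrime.isCoprime fun e hea hef => hasf e (mul_dvd_mul ?_ hea)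
    exact hdgcd e (hea.mul_left d) (hef.mul_left d)
  have hzero {u v w : k[X]} (h : IsHalvingSol g (d * a₁) d a₁ f₁ b s u v w) (hw : w = 0) :
      u = 0 ∧ v = 0 := by
    subst hw
    exact h.eq_zero hf hfdeg hasf hcop hb
  refine ⟨fun u v u' v' w _ h h' => ?_, ?_⟩
  · simpa only [sub_eq_zero] using hzero (h.sub h') (sub_self w)
  obtain ⟨u₀, v₀, w₀, h₀, hn₀⟩ := IsHalvingSol.exists_ne_zero b s hd0 ha0 hf0 hfdeg
  let S : Set (k[X] × k[X] × k[X]) := {x | IsHalvingSol g (d * a₁) d a₁ f₁ b s x.1 x.2.1 x.2.2 ∧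
    ¬ (x.1 = 0 ∧ x.2.1 = 0 ∧ x.2.2 = 0)}
  obtain ⟨⟨u, v, w⟩, ⟨h, hn⟩, hmin⟩ :=
    (measure fun x : k[X] × k[X] × k[X] => x.2.2.natDegree).wf.has_min S ⟨(u₀, v₀, w₀), h₀, hn₀⟩
  simp only at h hn
  have hne {u v w : k[X]} (h : IsHalvingSol g (d * a₁) d a₁ f₁ b s u v w)
      (hn : ¬ (u = 0 ∧ v = 0 ∧ w = 0)) : w ≠ 0 := fun hw =>
    hn ⟨(hzero h hw).1, (hzero h hw).2, hw⟩
  have hw := hne h hn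
  have hlc : w.leadingCoeff⁻¹ ≠ 0 := inv_ne_zero (leadingCoeff_ne_zero.2 hw)
  have hmonic : (C w.leadingCoeff⁻¹ * w).Monic := by
    rw [Monic, leadingCoeff_mul, leadingCoeff_C]
    exact inv_mul_cancel₀ (leadingCoeff_ne_zero.2 hw)
  have hsol := h.C_mul hlc
  refine ⟨(C w.leadingCoeff⁻¹ * u, C w.leadingCoeff⁻¹ * v, C w.leadingCoeff⁻¹ * w),
    ⟨hsol, fun h0 => hmonic.ne_zero h0.2.2, hmonic, fun u' v' w' h' hn' => ?_⟩, ?_⟩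
  · rw [degree_C_mul hlc, degree_eq_natDegree hw, degree_eq_natDegree (hne h' hn')]
    exact_mod_cast not_lt.1 (hmin (u', v', w') ⟨h', hn'⟩)
  · rintro ⟨u', v', w'⟩ ⟨h', hn', hm', hmin'⟩
    simp only at h' hn' hm' hmin'
    have hle : w'.degree ≤ (C w.leadingCoeff⁻¹ * w).degree :=
      hmin' _ _ _ hsol fun h0 => hmonic.ne_zero h0.2.2
    have hge : (C w.leadingCoeff⁻¹ * w).degree ≤ w'.degree := by
      rw [degree_C_mul hlc, degree_eq_natDegree hw, degree_eq_natDegree (hne h' hn')]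
      exact_mod_cast not_lt.1 (hmin (u', v', w') ⟨h', hn'⟩)
    have hlt : (w' - C w.leadingCoeff⁻¹ * w).degree < w'.degree :=
      degree_sub_lt_left (hle.antisymm hge) hm'.ne_zero (by rw [hm'.leadingCoeff, hmonic.leadingCoeff])
    have hsub := h'.sub hsol
    by_contra hdiff
    refine (hmin' _ _ _ hsub fun h0 => hdiff ?_).not_gt hlt
    simp only [sub_eq_zero] at h0
    rw [h0.1, h0.2.1, ← h0.2.2]
end

section
/- In the setting of the halving data (k, f, g, c, a, d, a₁, f₁, b, s): let (u, v, w) be a nontrivial solution of the system in which w is monic of minimal degree among the w-components of all nontrivial solutions, and let d₁ = gcd(u, w) (monic). Then d₁ divides v, d₁ divides f·a₁ (= a₁·f₁·d), and d₁ is squarefree. -/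
open Polynomial

/-- If `x²` divides `d y²` with `d` squarefree, then `x` divides `y`. -/
theorem dvd_of_mul_self_dvd_squarefree_mul {k : Type*} [Field k] {d x y : Polynomial k}
    (hd : Squarefree d) (hx : x ≠ 0) (h : x * x ∣ d * (y * y)) : x ∣ y := by
  classical
  have hg : EuclideanDomain.gcd x y ≠ 0 := fun h0 => hx (EuclideanDomain.gcd_eq_zero_iff.1 h0).1
  obtain ⟨x', hx'⟩ := EuclideanDomain.gcd_dvd_left x y
  obtain ⟨y', hy'⟩ := EuclideanDomain.gcd_dvd_right x y
  have hbez := EuclideanDomain.gcd_eq_gcd_ab x y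
  set r := EuclideanDomain.gcd x y
  have hcop : IsCoprime x' y' := by
    refine ⟨EuclideanDomain.gcdA x y, EuclideanDomain.gcdB x y, mul_left_cancel₀ hg ?_⟩
    linear_combination -hbez - EuclideanDomain.gcdA x y * hx' - EuclideanDomain.gcdB x y * hy'
  have h1 : x' * x' ∣ d * (y' * y') := by
    have : (r * r) * (x' * x') ∣ (r * r) * (d * (y' * y')) := by
      convert h using 1
      · rw [hx']; ring
      · rw [hy']; ring
    exact (mul_dvd_mul_iff_left (mul_ne_zero hg hg)).1 this
  have h2 : x' * x' ∣ d :=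
    IsCoprime.dvd_of_dvd_mul_right
      ((hcop.mul_left hcop).mul_right (hcop.mul_left hcop)) h1
  have hu : IsUnit x' := hd x' h2
  rw [hx', hy']
  exact mul_dvd_mul_left r (hu.dvd)

/-- Factors of a squarefree polynomial are coprime. -/
theorem isCoprime_of_squarefree_mul {k : Type*} [Field k] {x y : Polynomial k}
    (h : Squarefree (x * y)) : IsCoprime x y :=
  (squarefree_mul_iff.1 h).1.isCoprime

/-- Solutions of the halving system lie on the conic `d v² = f₁ u² + e a₁ w²`. -/
theorem IsHalvingSol.conic {k : Type*} [Field k] {g : ℕ} {a d a₁ f₁ b s u v w : Polynomial k}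
    {e : k} (hsol : IsHalvingSol g a d a₁ f₁ b s u v w)
    (ha : a = d * a₁) (ha0 : a ≠ 0) (hfdeg : (d * f₁).natDegree = 2 * g + 1)
    (hdf : IsCoprime d f₁) (hda : IsCoprime d a₁) (haf : IsCoprime a₁ f₁)
    (hb : a ∣ d * f₁ - b ^ 2) (hs : d * f₁ ∣ C e * (a - a₁ * f₁) - s ^ 2) :
    v ^ 2 * d = u ^ 2 * f₁ + C e * (w ^ 2 * a₁) := by
  obtain ⟨h1, h2, h3, hu, hv, hw⟩ := hsol
  have hd0 : d ≠ 0 := by rintro rfl; simp at ha; exact ha0 ha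
  have ha₁0 : a₁ ≠ 0 := by rintro rfl; simp at ha; exact ha0 ha
  have hf₁0 : f₁ ≠ 0 := by rintro rfl; simp at hfdeg
  rw [← sub_eq_zero]
  have hdvd1 : f₁ ∣ v ^ 2 * d - (u ^ 2 * f₁ + C e * (w ^ 2 * a₁)) := by
    refine hdf.symm.dvd_of_dvd_mul_left ?_
    obtain ⟨p, hp⟩ := h1
    obtain ⟨q, hq⟩ := hs
    exact ⟨p * (v * d + w * s) - w ^ 2 * (d * q) - d * u ^ 2 - C e * w ^ 2 * a₁, by
      linear_combination (v * d + w * s) * hp - w ^ 2 * hq + C e * w ^ 2 * ha⟩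
  have hdvd2 : a₁ ∣ v ^ 2 * d - (u ^ 2 * f₁ + C e * (w ^ 2 * a₁)) := by
    refine hda.symm.dvd_of_dvd_mul_left ?_
    obtain ⟨p, hp⟩ := h2
    obtain ⟨q, hq⟩ := hb
    exact ⟨p * (v * d + u * b) - u ^ 2 * d * q - d * C e * w ^ 2, by
      linear_combination (v * d + u * b) * hp - u ^ 2 * hq - u ^ 2 * q * ha⟩
  have hdvd3 : d ∣ v ^ 2 * d - (u ^ 2 * f₁ + C e * (w ^ 2 * a₁)) := by
    refine hdf.dvd_of_dvd_mul_left ?_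
    obtain ⟨p, hp⟩ := h3
    obtain ⟨q, hq⟩ := hs
    exact ⟨f₁ * v ^ 2 - p * (u * f₁ + w * s) + w ^ 2 * (f₁ * q) - C e * w ^ 2 * a₁, by
      linear_combination -(u * f₁ + w * s) * hp + w ^ 2 * hq - C e * w ^ 2 * ha⟩
  have hdvd : d * f₁ * a₁ ∣ v ^ 2 * d - (u ^ 2 * f₁ + C e * (w ^ 2 * a₁)) :=
    (hda.mul_left haf.symm).mul_dvd (hdf.mul_dvd hdvd3 hdvd1) hdvd2
  refine eq_zero_of_dvd_of_degree_lt hdvd ?_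
  rw [natDegree_mul hd0 hf₁0] at hfdeg
  rw [ha] at hu hv
  have hsq (x y : Polynomial k) (hy : y ≠ 0)
      (h : x ≠ 0 → 2 * x.natDegree + y.natDegree < 2 * g + 1 + a₁.natDegree) :
      (x ^ 2 * y).degree < (d * f₁ * a₁).degree := by
    have hne : d * f₁ * a₁ ≠ 0 := mul_ne_zero (mul_ne_zero hd0 hf₁0) ha₁0
    by_cases hx : x = 0
    · simpa [hx, bot_lt_iff_ne_bot] using ⟨⟨hd0, hf₁0⟩, ha₁0⟩
    · refine degree_lt_degree ?_
      rw [natDegree_mul (pow_ne_zero 2 hx) hy, natDegree_pow,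
        natDegree_mul (mul_ne_zero hd0 hf₁0) ha₁0, natDegree_mul hd0 hf₁0]
      have := h hx
      omega
  refine (degree_sub_le _ _).trans_lt (max_lt (hsq v d hd0 fun hx => ?_)
    ((degree_add_le _ _).trans_lt (max_lt (hsq u f₁ hf₁0 fun hx => ?_)
      ((C_mul' e (w ^ 2 * a₁) ▸ degree_smul_le e (w ^ 2 * a₁)).trans_lt
        (hsq w a₁ ha₁0 fun hx => ?_)))))
  · rw [degree_mul, degree_eq_natDegree hx, degree_eq_natDegree hd0,
      degree_eq_natDegree ha₁0] at hv
    norm_cast at hv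
    omega
  · rw [degree_mul, degree_eq_natDegree hx, degree_eq_natDegree hd0,
      degree_eq_natDegree ha₁0] at hu
    norm_cast at hu
    omega
  · rw [degree_eq_natDegree hx] at hw
    norm_cast at hw
    omega

/-- A common factor `q` of a solution `(q h u, q h v, q h w)` can be cancelled as soon as
`h` is a combination of `q h` and of a common multiple `m` of the moduli. -/
theorem IsHalvingSol.cancel {k : Type*} [Field k] {g : ℕ}
    {a d a₁ f₁ b s u v w h q m α β : Polynomial k}
    (hsol : IsHalvingSol g a d a₁ f₁ b s (h * q * u) (h * q * v) (h * q * w))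
    (hq : q ≠ 0) (hbez : h = h * q * α + m * β) (hmf : f₁ ∣ m) (hma : a₁ ∣ m) (hmd : d ∣ m) :
    IsHalvingSol g a d a₁ f₁ b s (h * u) (h * v) (h * w) := by
  obtain ⟨h1, h2, h3, hu, hv, hw⟩ := hsol
  have hdeg (x : Polynomial k) : (h * x).degree ≤ (h * q * x).degree := by
    rw [mul_right_comm]
    exact degree_le_mul_left _ hq
  have key {n t : Polynomial k} (hn : n ∣ m) (ht : n ∣ h * q * t) : n ∣ h * t := by
    rw [hbez, show (h * q * α + m * β) * t = h * q * t * α + m * (β * t) by ring]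
    exact dvd_add (ht.mul_right _) (hn.mul_right _)
  refine ⟨?_, ?_, ?_, (add_le_add (hdeg u) (hdeg u)).trans_lt hu, le_trans ?_ hv,
    (hdeg w).trans hw⟩
  · convert key (t := v * d - w * s) hmf (by convert h1 using 1; ring) using 1; ring
  · convert key (t := v * d - u * b) hma (by convert h2 using 1; ring) using 1; ring
  · convert key (t := u * f₁ - w * s) hmd (by convert h3 using 1; ring) using 1; ring
  · gcongr <;> exact hdeg v

/-- Proposition 5.1: for a nontrivial solution `(u, v, w)` with `w` monic of minimal
degree among the `w`-components of all nontrivial solutions, the (monic) gcd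
`d₁ = gcd(u, w)` divides `v`, divides `f·a₁`, and is squarefree. -/
theorem stmt19 (k : Type*) [Field k] (hchar : (2 : k) ≠ 0)
    (g : ℕ) (f : Polynomial k) (hf : Squarefree f) (hfdeg : f.natDegree = 2 * g + 1)
    (c : k) (hc : f.leadingCoeff = c)
    (a : Polynomial k) (ham : a.Monic) (hasf : Squarefree a)
    (hadeg : a.natDegree ≤ 2 * g + 1)
    (d a₁ f₁ : Polynomial k) (hdm : d.Monic) (hda : d ∣ a) (hdf : d ∣ f)
    (hdgcd : ∀ e : Polynomial k, e ∣ a → e ∣ f → e ∣ d)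
    (ha₁ : a = d * a₁) (hf₁ : f = d * f₁)
    (b s : Polynomial k) (hb : a ∣ f - b ^ 2)
    (hs : f ∣ Polynomial.C ((-c) ^ a.natDegree) * (a - a₁ * f₁) - s ^ 2)
    (u v w : Polynomial k) (hsol : IsHalvingSol g a d a₁ f₁ b s u v w)
    (hnt : ¬ (u = 0 ∧ v = 0 ∧ w = 0)) (hwm : w.Monic)
    (hmin : ∀ u' v' w' : Polynomial k, IsHalvingSol g a d a₁ f₁ b s u' v' w' →
      ¬ (u' = 0 ∧ v' = 0 ∧ w' = 0) → w.degree ≤ w'.degree)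
    (d₁ : Polynomial k) (hd₁m : d₁.Monic) (hd₁u : d₁ ∣ u) (hd₁w : d₁ ∣ w)
    (hd₁gcd : ∀ e : Polynomial k, e ∣ u → e ∣ w → e ∣ d₁) :
    d₁ ∣ v ∧ d₁ ∣ f * a₁ ∧ Squarefree d₁ := by
  classical
  subst hf₁
  have hw0 : w ≠ 0 := hwm.ne_zero
  have hd₁0 : d₁ ≠ 0 := hd₁m.ne_zero
  have hcdf : IsCoprime d f₁ := isCoprime_of_squarefree_mul hf
  have hcda : IsCoprime d a₁ := isCoprime_of_squarefree_mul (ha₁ ▸ hasf)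
  have hcaf : IsCoprime a₁ f₁ := by
    refine IsRelPrime.isCoprime fun x hxa hxf => ?_
    have hxd : x ∣ d := hdgcd x (ha₁ ▸ hxa.mul_left d) (hxf.mul_left d)
    exact hcda.isRelPrime hxd hxa
  have hfa : Squarefree (d * f₁ * a₁) := by
    rw [squarefree_mul_iff]
    exact ⟨(hcda.mul_left hcaf.symm).isRelPrime, hf,
      (ha₁ ▸ hasf : Squarefree (d * a₁)).of_mul_right⟩
  have hconic := hsol.conic ha₁ ham.ne_zero hfdeg hcdf hcda hcaf hb hs
  have hd₁v : d₁ ∣ v := by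
    refine dvd_of_mul_self_dvd_squarefree_mul hf.of_mul_left hd₁0 ?_
    rw [show d * (v * v) = v ^ 2 * d by ring, hconic, ← sq]
    exact dvd_add ((pow_dvd_pow_of_dvd hd₁u 2).mul_right _)
      (((pow_dvd_pow_of_dvd hd₁w 2).mul_right _).mul_left _)
  have hd₁f : d₁ ∣ d * f₁ * a₁ := by
    have hbez := EuclideanDomain.gcd_eq_gcd_ab d₁ (d * f₁ * a₁)
    obtain ⟨q, hq⟩ := EuclideanDomain.gcd_dvd_left d₁ (d * f₁ * a₁)
    have hdvd := EuclideanDomain.gcd_dvd_right d₁ (d * f₁ * a₁)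
    generalize EuclideanDomain.gcd d₁ (d * f₁ * a₁) = h at hbez hq hdvd
    obtain ⟨u', rfl⟩ := hd₁u
    obtain ⟨v', rfl⟩ := hd₁v
    obtain ⟨w', rfl⟩ := hd₁w
    have hq0 : q ≠ 0 := by rintro rfl; simp at hq; exact hd₁0 hq
    have hh0 : h * w' ≠ 0 := by
      rintro h0
      refine hw0 ?_
      rw [hq, mul_right_comm, h0, zero_mul]
    rw [hq] at hsol hbez
    have hsol' := hsol.cancel hq0 hbez (Dvd.intro_left d rfl |>.mul_right a₁)
      (dvd_mul_left a₁ _) ((dvd_mul_right d f₁).mul_right a₁)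
    have hle := hmin _ _ _ hsol' fun h0 => hh0 h0.2.2
    have hqu : IsUnit q := by
      rw [hq, mul_right_comm, degree_mul, degree_eq_natDegree hh0, degree_eq_natDegree hq0] at hle
      norm_cast at hle
      rw [isUnit_iff_degree_eq_zero, degree_eq_natDegree hq0]
      norm_cast
      omega
    rw [hq]
    exact (hqu.mul_right_dvd).2 hdvd
  exact ⟨hd₁v, hd₁f, hfa.squarefree_of_dvd hd₁f⟩
end
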